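/- arXiv:2404.13913 — 4 statements merged into one kernel-verified Lean document; each statement's English description precedes it below -/
import Mathlib

section
/- Let F be a finite field and let R^(1), R^(2), R^(3), R^(4) be 3×3 matrices over F satisfying the direct-sum tetrahedron equation R^(1)_{123} R^(2)_{145} R^(3)_{246} R^(4)_{356} = R^(4)_{356} R^(3)_{246} R^(2)_{145} R^(1)_{123}. Then the corresponding permutation-type quantum operators satisfy the quantum tetrahedron equation ℛ^(1)_{123} ℛ^(2)_{145} ℛ^(3)_{246} ℛ^(4)_{356} = ℛ^(4)_{356} ℛ^(3)_{246} ℛ^(2)_{145} ℛ^(1)_{123} as complex matrices indexed by F^6. -/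
open Matrix

/-- For a 3×3 matrix `R` over `F` and distinct indices `i j k : Fin 6`, the 6×6 matrix
which equals `R` on the rows and columns `i, j, k` and the identity elsewhere. -/
def embed {F : Type*} [Zero F] [One F] (R : Matrix (Fin 3) (Fin 3) F)
    (i j k : Fin 6) : Matrix (Fin 6) (Fin 6) F := fun a b =>
  if a = i then (if b = i then R 0 0 else if b = j then R 0 1 else if b = k then R 0 2 else 0)
  else if a = j then (if b = i then R 1 0 else if b = j then R 1 1 else if b = k then R 1 2 else 0)
  else if a = k then (if b = i then R 2 0 else if b = j then R 2 1 else if b = k then R 2 2 else 0)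
  else if a = b then 1 else 0

/-- The quantization of a 6×6 matrix `M` over a finite field `F`. -/
def quant {F : Type*} [Field F] [Fintype F] [DecidableEq F]
    (M : Matrix (Fin 6) (Fin 6) F) : Matrix (Fin 6 → F) (Fin 6 → F) ℂ :=
  fun x y => if Matrix.vecMul x M = y then 1 else 0

theorem quant_mul_aux {F : Type*} [Field F] [Fintype F] [DecidableEq F]
    (M N : Matrix (Fin 6) (Fin 6) F) : quant M * quant N = quant (M * N) := by
  ext x y
  simp only [quant, Matrix.mul_apply, ite_mul, one_mul, zero_mul]
  rw [Finset.sum_ite_eq]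
  simp only [Finset.mem_univ, if_true, Matrix.vecMul_vecMul]

/-- If `R⁽¹⁾, R⁽²⁾, R⁽³⁾, R⁽⁴⁾` satisfy the tetrahedron equation in a direct sum, then the
permutation-type quantum operators satisfy the quantum tetrahedron equation. -/
theorem quantum_tetrahedron_of_direct_sum {F : Type*} [Field F] [Fintype F] [DecidableEq F]
    (R1 R2 R3 R4 : Matrix (Fin 3) (Fin 3) F)
    (h : embed R1 0 1 2 * embed R2 0 3 4 * embed R3 1 3 5 * embed R4 2 4 5 =
         embed R4 2 4 5 * embed R3 1 3 5 * embed R2 0 3 4 * embed R1 0 1 2) :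
    quant (embed R1 0 1 2) * quant (embed R2 0 3 4) * quant (embed R3 1 3 5) *
        quant (embed R4 2 4 5) =
      quant (embed R4 2 4 5) * quant (embed R3 1 3 5) * quant (embed R2 0 3 4) *
        quant (embed R1 0 1 2) := by
  simp only [quant_mul_aux, h]
end

section
/- Let F be a finite field and let R^(1), R^(2), R^(3), R^(4), S^(4) be 3×3 matrices over F such that both R^(1)_{123} R^(2)_{145} R^(3)_{246} R^(4)_{356} = R^(4)_{356} R^(3)_{246} R^(2)_{145} R^(1)_{123} and R^(1)_{123} R^(2)_{145} R^(3)_{246} S^(4)_{356} = S^(4)_{356} R^(3)_{246} R^(2)_{145} R^(1)_{123} hold. Then for all complex numbers λ and μ, the quantum tetrahedron relation ℛ^(1)_{123} ℛ^(2)_{145} ℛ^(3)_{246} (λ ℛ^(4)_{356} + μ 𝒮^(4)_{356}) = (λ ℛ^(4)_{356} + μ 𝒮^(4)_{356}) ℛ^(3)_{246} ℛ^(2)_{145} ℛ^(1)_{123} holds. -/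
open Matrix

/-- If both `R⁽⁴⁾` and `S⁽⁴⁾` satisfy the direct-sum tetrahedron equation with the same
`R⁽¹⁾, R⁽²⁾, R⁽³⁾`, then any complex linear combination `λ ℛ⁽⁴⁾ + μ 𝒮⁽⁴⁾` satisfies the
quantum tetrahedron equation with the quantum operators `ℛ⁽¹⁾, ℛ⁽²⁾, ℛ⁽³⁾`. -/
theorem quantum_tetrahedron_linear_combination {F : Type*} [Field F] [Fintype F] [DecidableEq F]
    (R1 R2 R3 R4 S4 : Matrix (Fin 3) (Fin 3) F)
    (h1 : embed R1 0 1 2 * embed R2 0 3 4 * embed R3 1 3 5 * embed R4 2 4 5 =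
          embed R4 2 4 5 * embed R3 1 3 5 * embed R2 0 3 4 * embed R1 0 1 2)
    (h2 : embed R1 0 1 2 * embed R2 0 3 4 * embed R3 1 3 5 * embed S4 2 4 5 =
          embed S4 2 4 5 * embed R3 1 3 5 * embed R2 0 3 4 * embed R1 0 1 2)
    (lam mu : ℂ) :
    quant (embed R1 0 1 2) * quant (embed R2 0 3 4) * quant (embed R3 1 3 5) *
        (lam • quant (embed R4 2 4 5) + mu • quant (embed S4 2 4 5)) =
      (lam • quant (embed R4 2 4 5) + mu • quant (embed S4 2 4 5)) *
        quant (embed R3 1 3 5) * quant (embed R2 0 3 4) * quant (embed R1 0 1 2) := by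
  simp only [mul_add, add_mul, mul_smul_comm, smul_mul_assoc, quant_mul_aux, h1, h2]
end

section
/- Let F be a finite field and let R^(1), R^(2), R^(3), S^(3), R^(4), S^(4) be 3×3 matrices over F such that all four direct-sum tetrahedron relations hold: R^(1)_{123} R^(2)_{145} C_{246} D_{356} = D_{356} C_{246} R^(2)_{145} R^(1)_{123} for C ∈ {R^(3), S^(3)} and D ∈ {R^(4), S^(4)}. Then for all complex numbers α, β, λ, μ, the quantum tetrahedron relation ℛ^(1)_{123} ℛ^(2)_{145} (α ℛ^(3)_{246} + β 𝒮^(3)_{246}) (λ ℛ^(4)_{356} + μ 𝒮^(4)_{356}) = (λ ℛ^(4)_{356} + μ 𝒮^(4)_{356}) (α ℛ^(3)_{246} + β 𝒮^(3)_{246}) ℛ^(2)_{145} ℛ^(1)_{123} holds. -/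
open Matrix

theorem quant_mul {F : Type*} [Field F] [Fintype F] [DecidableEq F]
    (A B : Matrix (Fin 6) (Fin 6) F) : quant A * quant B = quant (A * B) := by
  ext x y
  simp only [quant, Matrix.mul_apply, ite_mul, one_mul, zero_mul, Finset.sum_ite_eq,
    Finset.mem_univ, if_true, Matrix.vecMul_vecMul]

/-- If all four direct-sum tetrahedron relations hold for `C ∈ {R⁽³⁾, S⁽³⁾}` and
`D ∈ {R⁽⁴⁾, S⁽⁴⁾}`, then the quantum tetrahedron relation holds with the linear
combinations `α ℛ⁽³⁾ + β 𝒮⁽³⁾` and `λ ℛ⁽⁴⁾ + μ 𝒮⁽⁴⁾`. -/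
theorem quantum_tetrahedron_two_linear_combinations
    {F : Type*} [Field F] [Fintype F] [DecidableEq F]
    (R1 R2 R3 S3 R4 S4 : Matrix (Fin 3) (Fin 3) F)
    (hRR : embed R1 0 1 2 * embed R2 0 3 4 * embed R3 1 3 5 * embed R4 2 4 5 =
           embed R4 2 4 5 * embed R3 1 3 5 * embed R2 0 3 4 * embed R1 0 1 2)
    (hRS : embed R1 0 1 2 * embed R2 0 3 4 * embed R3 1 3 5 * embed S4 2 4 5 =
           embed S4 2 4 5 * embed R3 1 3 5 * embed R2 0 3 4 * embed R1 0 1 2)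
    (hSR : embed R1 0 1 2 * embed R2 0 3 4 * embed S3 1 3 5 * embed R4 2 4 5 =
           embed R4 2 4 5 * embed S3 1 3 5 * embed R2 0 3 4 * embed R1 0 1 2)
    (hSS : embed R1 0 1 2 * embed R2 0 3 4 * embed S3 1 3 5 * embed S4 2 4 5 =
           embed S4 2 4 5 * embed S3 1 3 5 * embed R2 0 3 4 * embed R1 0 1 2)
    (α β lam mu : ℂ) :
    quant (embed R1 0 1 2) * quant (embed R2 0 3 4) *
        (α • quant (embed R3 1 3 5) + β • quant (embed S3 1 3 5)) *
        (lam • quant (embed R4 2 4 5) + mu • quant (embed S4 2 4 5)) =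
      (lam • quant (embed R4 2 4 5) + mu • quant (embed S4 2 4 5)) *
        (α • quant (embed R3 1 3 5) + β • quant (embed S3 1 3 5)) *
        quant (embed R2 0 3 4) * quant (embed R1 0 1 2) := by
  simp only [mul_add, add_mul, Matrix.mul_smul, Matrix.smul_mul, quant_mul, hRR, hRS, hSR, hSS,
    smul_smul, smul_add]
  simp only [mul_comm lam, mul_comm mu]
  abel
end

section
/- The number of quadruples (R^(1), R^(2), R^(3), R^(4)) of invertible 3×3 matrices over the field F_2 with two elements satisfying the direct-sum tetrahedron equation R^(1)_{123} R^(2)_{145} R^(3)_{246} R^(4)_{356} = R^(4)_{356} R^(3)_{246} R^(2)_{145} R^(1)_{123} is exactly 61535. -/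
open Matrix

/-!
# Counting solutions of the direct-sum tetrahedron equation over the field with two elements

Write `P = R1 R2 R3` and `Q = R3 R2 R1`.  The tetrahedron equation is a system of 36 polynomial
equations in 36 bits.  We count the solutions by a depth-first search over the bits (`L0`, `L1`, ...),
which tests every equation as soon as all of its bits are known, and which also discards a partial
assignment as soon as it is incompatible with invertibility.  The search is evaluated by the kernel;
`count_L0` says that it counts the solutions of the Boolean system `Sol`.
-/

namespace Tet

noncomputable section

/-! ### Boolean operations, written with the recursor so that the kernel evaluates them quickly -/

def an (x y : Bool) : Bool := Bool.rec false y x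
def bnot (x : Bool) : Bool := Bool.rec true false x
def xo (x y : Bool) : Bool := Bool.rec y (bnot y) x
def be (x y : Bool) : Bool := Bool.rec (bnot y) y x
def orr (x y : Bool) : Bool := Bool.rec y true x

/-- `n` if the test `x` succeeds and `0` otherwise. -/
def gd (x : Bool) (n : Nat) : Nat := Bool.rec 0 n x

/-- Sum over the two values of a bit. -/
def cb (f : Bool → Nat) : Nat := Nat.add (f false) (f true)

/-- A vector is nonzero. -/
def nz (x y z : Bool) : Bool := orr x (orr y z)

/-- Two vectors are linearly independent. -/
def rk (a b c d e f : Bool) : Bool :=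
  orr (xo (an a e) (an b d)) (orr (xo (an a f) (an c d)) (xo (an b f) (an c e)))

/-- The determinant of a 3×3 matrix. -/
def dt (a b c d e f g h i : Bool) : Bool :=
  xo (an a (xo (an e i) (an f h))) (xo (an b (xo (an d i) (an f g))) (an c (xo (an d h) (an e g))))

/-- A row of `R4` times a column of `R3 R2 R1`. -/
def rq (d0 d1 d2 a0 a1 a2 b10 b20 c20 c21 : Bool) : Bool :=
  xo (an d0 a2) (xo (an d1 (an a0 b20)) (an d2 (xo (an a1 c20) (an a0 (an b10 c21)))))

/-! ### The entries of the tetrahedron equation -/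

def e01 (a00 a01 b00 b01 c00 c10 : Bool) : Bool := be (xo (an a01 c00) (an a00 (an b01 c10))) (an
  a01 b00)
def e02 (a00 a01 a02 b00 b01 b02 c02 c12 d00 d10 d20 : Bool) : Bool := be (xo (an a02 d00) (xo (an
  a00 (an b02 d10)) (xo (an a01 (an c02 d20)) (an a00 (an b01 (an c12 d20)))))) (an a02 b00)
def e03 (a00 a01 b01 c01 c11 : Bool) : Bool := be (xo (an a01 c01) (an a00 (an b01 c11))) b01
def e04 (a00 a01 a02 b01 b02 c02 c12 d01 d11 d21 : Bool) : Bool := be (xo (an a02 d01) (xo (an a00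
  (an b02 d11)) (xo (an a01 (an c02 d21)) (an a00 (an b01 (an c12 d21)))))) b02
def e05 (a00 a01 a02 b01 b02 c02 c12 d02 d12 d22 : Bool) : Bool := be (xo (an a02 d02) (xo (an a00
  (an b02 d12)) (xo (an a01 (an c02 d22)) (an a00 (an b01 (an c12 d22)))))) false
def e10 (a00 a10 b00 b10 c00 c01 : Bool) : Bool := be (an a10 b00) (xo (an a10 c00) (an a00 (an
  b10 c01)))
def e11 (a01 a10 b01 b10 c01 c10 : Bool) : Bool := be (an a10 (an b01 c10)) (an a01 (an b10 c01))
def e12 (a02 a10 a11 a12 b01 b02 b10 c00 c01 c02 c12 d00 d10 d20 : Bool) : Bool := be (xo (an a12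
  d00) (xo (an a10 (an b02 d10)) (xo (an a11 (an c02 d20)) (an a10 (an b01 (an c12 d20)))))) (xo
  (an a12 c00) (an a02 (an b10 c01)))
def e13 (a10 a11 b01 b11 c01 c11 : Bool) : Bool := be (xo (an a11 c01) (an a10 (an b01 c11))) (an
  b11 c01)
def e14 (a10 a11 a12 b01 b02 b12 c01 c02 c12 d01 d11 d21 : Bool) : Bool := be (xo (an a12 d01) (xo
  (an a10 (an b02 d11)) (xo (an a11 (an c02 d21)) (an a10 (an b01 (an c12 d21)))))) (an b12 c01)
def e15 (a10 a11 a12 b01 b02 c02 c12 d02 d12 d22 : Bool) : Bool := be (xo (an a12 d02) (xo (an a10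
  (an b02 d12)) (xo (an a11 (an c02 d22)) (an a10 (an b01 (an c12 d22)))))) c02
def e20 (a00 a10 a20 b00 b10 b20 c20 c21 d00 d01 d02 : Bool) : Bool := be (an a20 b00) (rq d00 d01
  d02 a00 a10 a20 b10 b20 c20 c21)
def e21 (a01 a11 a20 a21 b01 b10 b20 c00 c10 c20 c21 d00 d01 d02 : Bool) : Bool := be (xo (an a21
  c00) (an a20 (an b01 c10))) (rq d00 d01 d02 a01 a11 a21 b10 b20 c20 c21)
def e22 (a02 a12 a20 a21 b01 b02 b10 b20 c02 c12 c20 c21 d01 d02 d10 d20 : Bool) : Bool := be (xo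
  (an a20 (an b02 d10)) (xo (an a21 (an c02 d20)) (an a20 (an b01 (an c12 d20))))) (xo (an a02 (an
  b20 d01)) (xo (an a12 (an c20 d02)) (an a02 (an b10 (an c21 d02)))))
def e23 (a20 a21 b01 b11 b21 c01 c11 c21 d01 d02 : Bool) : Bool := be (xo (an a21 c01) (an a20 (an
  b01 c11))) (xo (an b21 d01) (an b11 (an c21 d02)))
def e24 (a20 a21 a22 b01 b02 b12 b22 c02 c12 c21 d01 d02 d11 d21 : Bool) : Bool := be (xo (an a22
  d01) (xo (an a20 (an b02 d11)) (xo (an a21 (an c02 d21)) (an a20 (an b01 (an c12 d21)))))) (xo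
  (an b22 d01) (an b12 (an c21 d02)))
def e25 (a20 a21 a22 b01 b02 c02 c12 c22 d02 d12 d22 : Bool) : Bool := be (xo (an a22 d02) (xo (an
  a20 (an b02 d12)) (xo (an a21 (an c02 d22)) (an a20 (an b01 (an c12 d22)))))) (an c22 d02)
def e30 (a00 a10 b10 c10 c11 : Bool) : Bool := be b10 (xo (an a10 c10) (an a00 (an b10 c11)))
def e31 (a01 a11 b10 b11 c10 c11 : Bool) : Bool := be (an b11 c10) (xo (an a11 c10) (an a01 (an
  b10 c11)))
def e32 (a02 a12 b10 b11 b12 c10 c11 c12 d10 d20 : Bool) : Bool := be (xo (an b12 d10) (an b11 (an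
  c12 d20))) (xo (an a12 c10) (an a02 (an b10 c11)))
def e34 (b11 b12 c11 c12 d11 d21 : Bool) : Bool := be (xo (an b12 d11) (an b11 (an c12 d21))) (an
  b12 c11)
def e35 (b11 b12 c12 d12 d22 : Bool) : Bool := be (xo (an b12 d12) (an b11 (an c12 d22))) c12
def e40 (a00 a10 a20 b10 b20 c20 c21 d10 d11 d12 : Bool) : Bool := be b20 (rq d10 d11 d12 a00 a10
  a20 b10 b20 c20 c21)
def e41 (a01 a11 a21 b10 b20 b21 c10 c20 c21 d10 d11 d12 : Bool) : Bool := be (an b21 c10) (rq d10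
  d11 d12 a01 a11 a21 b10 b20 c20 c21)
def e42 (a02 a12 a22 b10 b20 b21 b22 c12 c20 c21 d10 d11 d12 d20 : Bool) : Bool := be (xo (an b22
  d10) (an b21 (an c12 d20))) (xo (an a22 d10) (xo (an a02 (an b20 d11)) (xo (an a12 (an c20 d12))
  (an a02 (an b10 (an c21 d12))))))
def e43 (b11 b21 c11 c21 d11 d12 : Bool) : Bool := be (an b21 c11) (xo (an b21 d11) (an b11 (an
  c21 d12)))
def e44 (b12 b21 c12 c21 d12 d21 : Bool) : Bool := be (an b21 (an c12 d21)) (an b12 (an c21 d12))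
def e45 (b21 b22 c12 c22 d12 d22 : Bool) : Bool := be (xo (an b22 d12) (an b21 (an c12 d22))) (an
  c22 d12)
def e50 (a00 a10 a20 b10 b20 c20 c21 d20 d21 d22 : Bool) : Bool := be false (rq d20 d21 d22 a00
  a10 a20 b10 b20 c20 c21)
def e51 (a01 a11 a21 b10 b20 c20 c21 d20 d21 d22 : Bool) : Bool := be c20 (rq d20 d21 d22 a01 a11
  a21 b10 b20 c20 c21)
def e52 (a02 a12 a22 b10 b20 c20 c21 c22 d20 d21 d22 : Bool) : Bool := be (an c22 d20) (xo (an a22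
  d20) (xo (an a02 (an b20 d21)) (xo (an a12 (an c20 d22)) (an a02 (an b10 (an c21 d22))))))
def e53 (b11 b21 c21 d21 d22 : Bool) : Bool := be c21 (xo (an b21 d21) (an b11 (an c21 d22)))
def e54 (b12 b22 c21 c22 d21 d22 : Bool) : Bool := be (an c22 d21) (xo (an b22 d21) (an b12 (an
  c21 d22)))

/-! ### The search -/

def L10 (a00 b10 c10 c11 a10 a01 b01 c01 a11 b11 c00 b00 b02 b12 c02 c12 a12 a02 d10 d20 d00 d11
    d21 d01 d22 d12 d02 b21 c21 c20 a20 b20 a21 : Bool) : Nat :=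
  cb fun c22 => gd (dt c00 c01 c02 c10 c11 c12 c20 c21 c22) <|
  cb fun b22 => gd (e45 b21 b22 c12 c22 d12 d22) <| gd (e54 b12 b22 c21 c22 d21 d22) <| gd (dt b00
    b01 b02 b10 b11 b12 b20 b21 b22) <|
  cb fun a22 => gd (e25 a20 a21 a22 b01 b02 c02 c12 c22 d02 d12 d22) <| gd (e52 a02 a12 a22 b10
    b20 c20 c21 c22 d20 d21 d22) <| gd (e24 a20 a21 a22 b01 b02 b12 b22 c02 c12 c21 d01 d02 d11
    d21) <| gd (e42 a02 a12 a22 b10 b20 b21 b22 c12 c20 c21 d10 d11 d12 d20) <| gd (dt a00 a01 a02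
    a10 a11 a12 a20 a21 a22) <|
  1

def L9 (a00 b10 c10 c11 a10 a01 b01 c01 a11 b11 c00 b00 b02 b12 c02 c12 a12 a02 d10 d20 d00 d11
    d21 d01 d22 d12 d02 b21 c21 c20 : Bool) : Nat :=
  cb fun a20 => gd (nz a00 a10 a20) <|
  cb fun b20 => gd (e50 a00 a10 a20 b10 b20 c20 c21 d20 d21 d22) <| gd (e20 a00 a10 a20 b00 b10
    b20 c20 c21 d00 d01 d02) <| gd (e40 a00 a10 a20 b10 b20 c20 c21 d10 d11 d12) <| gd (rk b00 b10
    b20 b01 b11 b21) <|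
  cb fun a21 => gd (e23 a20 a21 b01 b11 b21 c01 c11 c21 d01 d02) <| gd (e41 a01 a11 a21 b10 b20
    b21 c10 c20 c21 d10 d11 d12) <| gd (e51 a01 a11 a21 b10 b20 c20 c21 d20 d21 d22) <| gd (e21
    a01 a11 a20 a21 b01 b10 b20 c00 c10 c20 c21 d00 d01 d02) <| gd (e22 a02 a12 a20 a21 b01 b02
    b10 b20 c02 c12 c20 c21 d01 d02 d10 d20) <| gd (rk a00 a10 a20 a01 a11 a21) <|
  L10 a00 b10 c10 c11 a10 a01 b01 c01 a11 b11 c00 b00 b02 b12 c02 c12 a12 a02 d10 d20 d00 d11 d21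
    d01 d22 d12 d02 b21 c21 c20 a20 b20 a21

def L8 (a00 b10 c10 c11 a10 a01 b01 c01 a11 b11 c00 b00 b02 b12 c02 c12 a12 a02 d10 d20 d00 d11
    d21 d01 d22 d12 d02 : Bool) : Nat :=
  cb fun b21 => gd (nz b01 b11 b21) <|
  cb fun c21 => gd (e44 b12 b21 c12 c21 d12 d21) <| gd (e43 b11 b21 c11 c21 d11 d12) <| gd (e53
    b11 b21 c21 d21 d22) <| gd (nz c01 c11 c21) <|
  cb fun c20 => gd (rk c00 c10 c20 c01 c11 c21) <|
  L9 a00 b10 c10 c11 a10 a01 b01 c01 a11 b11 c00 b00 b02 b12 c02 c12 a12 a02 d10 d20 d00 d11 d21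
    d01 d22 d12 d02 b21 c21 c20

def L7 (a00 b10 c10 c11 a10 a01 b01 c01 a11 b11 c00 b00 b02 b12 c02 c12 a12 a02 d10 d20 d00 d11
    d21 d01 : Bool) : Nat :=
  cb fun d22 => gd (nz d20 d21 d22) <|
  cb fun d12 => gd (e35 b11 b12 c12 d12 d22) <| gd (rk d10 d11 d12 d20 d21 d22) <|
  cb fun d02 => gd (e05 a00 a01 a02 b01 b02 c02 c12 d02 d12 d22) <| gd (e15 a10 a11 a12 b01 b02
    c02 c12 d02 d12 d22) <| gd (dt d00 d01 d02 d10 d11 d12 d20 d21 d22) <|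
  L8 a00 b10 c10 c11 a10 a01 b01 c01 a11 b11 c00 b00 b02 b12 c02 c12 a12 a02 d10 d20 d00 d11 d21
    d01 d22 d12 d02

def L6 (a00 b10 c10 c11 a10 a01 b01 c01 a11 b11 c00 b00 b02 b12 c02 c12 a12 a02 d10 d20 d00 :
    Bool) : Nat :=
  cb fun d11 =>
  cb fun d21 => gd (e34 b11 b12 c11 c12 d11 d21) <|
  cb fun d01 => gd (e04 a00 a01 a02 b01 b02 c02 c12 d01 d11 d21) <| gd (e14 a10 a11 a12 b01 b02
    b12 c01 c02 c12 d01 d11 d21) <| gd (rk d00 d10 d20 d01 d11 d21) <|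
  L7 a00 b10 c10 c11 a10 a01 b01 c01 a11 b11 c00 b00 b02 b12 c02 c12 a12 a02 d10 d20 d00 d11 d21
    d01

def L5 (a00 b10 c10 c11 a10 a01 b01 c01 a11 b11 c00 b00 b02 b12 c02 c12 a12 a02 : Bool) : Nat :=
  cb fun d10 =>
  cb fun d20 => gd (e32 a02 a12 b10 b11 b12 c10 c11 c12 d10 d20) <|
  cb fun d00 => gd (nz d00 d10 d20) <| gd (e02 a00 a01 a02 b00 b01 b02 c02 c12 d00 d10 d20) <| gd
    (e12 a02 a10 a11 a12 b01 b02 b10 c00 c01 c02 c12 d00 d10 d20) <|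
  L6 a00 b10 c10 c11 a10 a01 b01 c01 a11 b11 c00 b00 b02 b12 c02 c12 a12 a02 d10 d20 d00

def L4 (a00 b10 c10 c11 a10 a01 b01 c01 a11 b11 c00 b00 b02 b12 c02 c12 : Bool) : Nat :=
  cb fun a12 => gd (nz a10 a11 a12) <|
  cb fun a02 => gd (rk a00 a01 a02 a10 a11 a12) <|
  L5 a00 b10 c10 c11 a10 a01 b01 c01 a11 b11 c00 b00 b02 b12 c02 c12 a12 a02

def L3 (a00 b10 c10 c11 a10 a01 b01 c01 a11 b11 c00 b00 : Bool) : Nat :=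
  cb fun b02 => gd (nz b00 b01 b02) <|
  cb fun b12 => gd (rk b00 b01 b02 b10 b11 b12) <|
  cb fun c02 => gd (nz c00 c01 c02) <|
  cb fun c12 => gd (rk c00 c01 c02 c10 c11 c12) <|
  L4 a00 b10 c10 c11 a10 a01 b01 c01 a11 b11 c00 b00 b02 b12 c02 c12

def L2 (a00 b10 c10 c11 a10 a01 b01 c01 : Bool) : Nat :=
  cb fun a11 =>
  cb fun b11 => gd (e13 a10 a11 b01 b11 c01 c11) <| gd (e31 a01 a11 b10 b11 c10 c11) <|
  cb fun c00 =>
  cb fun b00 => gd (e01 a00 a01 b00 b01 c00 c10) <| gd (e10 a00 a10 b00 b10 c00 c01) <|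
  L3 a00 b10 c10 c11 a10 a01 b01 c01 a11 b11 c00 b00

def L1 (a00 b10 c10 c11 : Bool) : Nat :=
  cb fun a10 => gd (e30 a00 a10 b10 c10 c11) <|
  cb fun a01 =>
  cb fun b01 =>
  cb fun c01 => gd (e11 a01 a10 b01 b10 c01 c10) <| gd (e03 a00 a01 b01 c01 c11) <|
  L2 a00 b10 c10 c11 a10 a01 b01 c01

def L0 : Nat :=
  cb fun a00 =>
  cb fun b10 =>
  cb fun c10 =>
  cb fun c11 =>
  L1 a00 b10 c10 c11

/-! ### Evaluation of the search -/

theorem L1_ffff : L1 false false false false = 1343 :=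
  Nat.eq_of_beq_eq_true (by decide +kernel)
theorem L1_ffft : L1 false false false true = 6031 :=
  Nat.eq_of_beq_eq_true (by decide +kernel)
theorem L1_fftf : L1 false false true false = 761 :=
  Nat.eq_of_beq_eq_true (by decide +kernel)
theorem L1_fftt : L1 false false true true = 997 :=
  Nat.eq_of_beq_eq_true (by decide +kernel)
theorem L1_ftff : L1 false true false false = 0 :=
  Nat.eq_of_beq_eq_true (by decide +kernel)
theorem L1_ftft : L1 false true false true = 0 :=
  Nat.eq_of_beq_eq_true (by decide +kernel)
theorem L1_fttf : L1 false true true false = 1102 :=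
  Nat.eq_of_beq_eq_true (by decide +kernel)
theorem L1_fttt : L1 false true true true = 1575 :=
  Nat.eq_of_beq_eq_true (by decide +kernel)
theorem L1_tfff : L1 true false false false = 2930 :=
  Nat.eq_of_beq_eq_true (by decide +kernel)
theorem L1_tfft : L1 true false false true = 22274 :=
  Nat.eq_of_beq_eq_true (by decide +kernel)
theorem L1_tftf : L1 true false true false = 4098 :=
  Nat.eq_of_beq_eq_true (by decide +kernel)
theorem L1_tftt : L1 true false true true = 5524 :=
  Nat.eq_of_beq_eq_true (by decide +kernel)
theorem L1_ttff : L1 true true false false = 0 :=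
  Nat.eq_of_beq_eq_true (by decide +kernel)
theorem L1_ttft : L1 true true false true = 10641 :=
  Nat.eq_of_beq_eq_true (by decide +kernel)
theorem L1_tttf : L1 true true true false = 1575 :=
  Nat.eq_of_beq_eq_true (by decide +kernel)
theorem L1_tttt : L1 true true true true = 2684 :=
  Nat.eq_of_beq_eq_true (by decide +kernel)

theorem sum_bits (f : Bool → Bool → Bool → Bool → Nat)
    (hffff : f false false false false = 1343)
    (hffft : f false false false true = 6031)
    (hfftf : f false false true false = 761)
    (hfftt : f false false true true = 997)
    (hftff : f false true false false = 0)
    (hftft : f false true false true = 0)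
    (hfttf : f false true true false = 1102)
    (hfttt : f false true true true = 1575)
    (htfff : f true false false false = 2930)
    (htfft : f true false false true = 22274)
    (htftf : f true false true false = 4098)
    (htftt : f true false true true = 5524)
    (httff : f true true false false = 0)
    (httft : f true true false true = 10641)
    (htttf : f true true true false = 1575)
    (htttt : f true true true true = 2684)
    : (cb fun a => cb fun b => cb fun c => cb fun d => f a b c d) = 61535 := by
  simp only [cb, hffff, hffft, hfftf, hfftt, hftff, hftft, hfttf, hfttt, htfff, htfft, htftf,
    htftt, httff, httft, htttf, htttt]

theorem L0_eq : L0 = 61535 :=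
  sum_bits L1 L1_ffff L1_ffft L1_fftf L1_fftt L1_ftff L1_ftft L1_fttf L1_fttt L1_tfff L1_tfft
    L1_tftf L1_tftt L1_ttff L1_ttft L1_tttf L1_tttt

/-! ### The Boolean system, and the correctness of the search -/

structure Sol (a00 a01 a02 a10 a11 a12 a20 a21 a22 b00 b01 b02 b10 b11 b12 b20 b21 b22 c00 c01 c02
    c10 c11 c12 c20 c21 c22 d00 d01 d02 d10 d11 d12 d20 d21 d22 : Bool) : Prop where
  dA : dt a00 a01 a02 a10 a11 a12 a20 a21 a22 = true
  dB : dt b00 b01 b02 b10 b11 b12 b20 b21 b22 = true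
  dC : dt c00 c01 c02 c10 c11 c12 c20 c21 c22 = true
  dD : dt d00 d01 d02 d10 d11 d12 d20 d21 d22 = true
  e01 : e01 a00 a01 b00 b01 c00 c10 = true
  e02 : e02 a00 a01 a02 b00 b01 b02 c02 c12 d00 d10 d20 = true
  e03 : e03 a00 a01 b01 c01 c11 = true
  e04 : e04 a00 a01 a02 b01 b02 c02 c12 d01 d11 d21 = true
  e05 : e05 a00 a01 a02 b01 b02 c02 c12 d02 d12 d22 = true
  e10 : e10 a00 a10 b00 b10 c00 c01 = true
  e11 : e11 a01 a10 b01 b10 c01 c10 = true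
  e12 : e12 a02 a10 a11 a12 b01 b02 b10 c00 c01 c02 c12 d00 d10 d20 = true
  e13 : e13 a10 a11 b01 b11 c01 c11 = true
  e14 : e14 a10 a11 a12 b01 b02 b12 c01 c02 c12 d01 d11 d21 = true
  e15 : e15 a10 a11 a12 b01 b02 c02 c12 d02 d12 d22 = true
  e20 : e20 a00 a10 a20 b00 b10 b20 c20 c21 d00 d01 d02 = true
  e21 : e21 a01 a11 a20 a21 b01 b10 b20 c00 c10 c20 c21 d00 d01 d02 = true
  e22 : e22 a02 a12 a20 a21 b01 b02 b10 b20 c02 c12 c20 c21 d01 d02 d10 d20 = true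
  e23 : e23 a20 a21 b01 b11 b21 c01 c11 c21 d01 d02 = true
  e24 : e24 a20 a21 a22 b01 b02 b12 b22 c02 c12 c21 d01 d02 d11 d21 = true
  e25 : e25 a20 a21 a22 b01 b02 c02 c12 c22 d02 d12 d22 = true
  e30 : e30 a00 a10 b10 c10 c11 = true
  e31 : e31 a01 a11 b10 b11 c10 c11 = true
  e32 : e32 a02 a12 b10 b11 b12 c10 c11 c12 d10 d20 = true
  e34 : e34 b11 b12 c11 c12 d11 d21 = true
  e35 : e35 b11 b12 c12 d12 d22 = true
  e40 : e40 a00 a10 a20 b10 b20 c20 c21 d10 d11 d12 = true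
  e41 : e41 a01 a11 a21 b10 b20 b21 c10 c20 c21 d10 d11 d12 = true
  e42 : e42 a02 a12 a22 b10 b20 b21 b22 c12 c20 c21 d10 d11 d12 d20 = true
  e43 : e43 b11 b21 c11 c21 d11 d12 = true
  e44 : e44 b12 b21 c12 c21 d12 d21 = true
  e45 : e45 b21 b22 c12 c22 d12 d22 = true
  e50 : e50 a00 a10 a20 b10 b20 c20 c21 d20 d21 d22 = true
  e51 : e51 a01 a11 a21 b10 b20 c20 c21 d20 d21 d22 = true
  e52 : e52 a02 a12 a22 b10 b20 c20 c21 c22 d20 d21 d22 = true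
  e53 : e53 b11 b21 c21 d21 d22 = true
  e54 : e54 b12 b22 c21 c22 d21 d22 = true

/-- `Sol` as a predicate on the vector of bits, in the order in which the search fixes them. -/
def SolV (x : Fin 36 → Bool) : Prop :=
  Sol (x 0) (x 5) (x 17) (x 4) (x 8) (x 16) (x 30) (x 32) (x 35) (x 11) (x 6) (x 12) (x 1) (x 9)
    (x 13) (x 31) (x 27) (x 34) (x 10) (x 7) (x 14) (x 2) (x 3) (x 15) (x 29) (x 28) (x 33) (x 20)
    (x 23) (x 26) (x 18) (x 21) (x 25) (x 19) (x 22) (x 24)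

/-- `n` is the number of bit vectors with the property `p`. -/
def Cnt {k : ℕ} (p : (Fin k → Bool) → Prop) (n : ℕ) : Prop := Nat.card {x // p x} = n

theorem Cnt.cb {k : ℕ} {p : (Fin (k + 1) → Bool) → Prop} {f : Bool → ℕ}
    (h : ∀ b, Cnt (fun y => p (vecCons b y)) (f b)) : Cnt p (cb f) := by
  have e : {x // p x} ≃ {y // p (vecCons false y)} ⊕ {y // p (vecCons true y)} :=
    { toFun := fun x => if h0 : x.1 0 = true
        then Sum.inr ⟨vecTail x.1, by
          have := x.2; rw [← cons_head_tail x.1] at this; rwa [vecHead, h0] at this⟩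
        else Sum.inl ⟨vecTail x.1, by
          have := x.2
          rw [← cons_head_tail x.1] at this
          rwa [vecHead, Bool.eq_false_of_not_eq_true h0] at this⟩
      invFun := Sum.elim (fun y => ⟨_, y.2⟩) (fun y => ⟨_, y.2⟩)
      left_inv := by
        rintro ⟨x, hx⟩
        by_cases h0 : x 0 = true
        · simp only [h0, ↓reduceDIte, Sum.elim_inr, Subtype.mk.injEq]
          refine Eq.trans ?_ (cons_head_tail x)
          rw [vecHead, h0]
        · simp only [h0, Bool.false_eq_true, ↓reduceDIte, Sum.elim_inl, Subtype.mk.injEq]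
          refine Eq.trans ?_ (cons_head_tail x)
          rw [vecHead, Bool.eq_false_of_not_eq_true h0]
      right_inv := by
        rintro (⟨y, hy⟩ | ⟨y, hy⟩) <;> simp }
  unfold Cnt
  rw [Nat.card_congr e, Nat.card_sum, h false, h true]
  rfl

theorem Cnt.gd {k : ℕ} {p : (Fin k → Bool) → Prop} {c : Bool} {n : ℕ}
    (h : ∀ y, p y → c = true) (h' : c = true → Cnt p n) : Cnt p (gd c n) := by
  cases c with
  | true => exact h' rfl
  | false =>
    have : IsEmpty {x // p x} := ⟨fun x => Bool.false_ne_true (h x.1 x.2)⟩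
    exact Nat.card_of_isEmpty

theorem Cnt.one {p : (Fin 0 → Bool) → Prop} (h : ∀ y, p y) : Cnt p 1 := by
  have : Unique {x // p x} := ⟨⟨⟨![], h _⟩⟩, fun x => Subtype.ext (Subsingleton.elim _ _)⟩
  exact Nat.card_unique

theorem nz_abc : ∀ {a b c d e f g h i : Bool}, dt a b c d e f g h i = true →
    nz a b c = true := by decide
theorem nz_adg : ∀ {a b c d e f g h i : Bool}, dt a b c d e f g h i = true →
    nz a d g = true := by decide
theorem nz_beh : ∀ {a b c d e f g h i : Bool}, dt a b c d e f g h i = true →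
    nz b e h = true := by decide
theorem nz_def : ∀ {a b c d e f g h i : Bool}, dt a b c d e f g h i = true →
    nz d e f = true := by decide
theorem nz_ghi : ∀ {a b c d e f g h i : Bool}, dt a b c d e f g h i = true →
    nz g h i = true := by decide
theorem rk_abcdef : ∀ {a b c d e f g h i : Bool}, dt a b c d e f g h i = true →
    rk a b c d e f = true := by decide
theorem rk_adgbeh : ∀ {a b c d e f g h i : Bool}, dt a b c d e f g h i = true →
    rk a d g b e h = true := by decide
theorem rk_defghi : ∀ {a b c d e f g h i : Bool}, dt a b c d e f g h i = true →
    rk d e f g h i = true := by decide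

/-- The search counts the solutions of the Boolean system. -/
theorem count_L0 : Cnt SolV L0 :=
  .cb fun _ =>
  .cb fun _ =>
  .cb fun _ =>
  .cb fun _ =>
  .cb fun _ => .gd (fun _ h => h.e30) fun h30 =>
  .cb fun _ =>
  .cb fun _ =>
  .cb fun _ => .gd (fun _ h => h.e11) fun h11 => .gd (fun _ h => h.e03) fun h03 =>
  .cb fun _ =>
  .cb fun _ => .gd (fun _ h => h.e13) fun h13 => .gd (fun _ h => h.e31) fun h31 =>
  .cb fun _ =>
  .cb fun _ => .gd (fun _ h => h.e01) fun h01 => .gd (fun _ h => h.e10) fun h10 =>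
  .cb fun _ => .gd (fun _ h => nz_abc h.dB) fun _ =>
  .cb fun _ => .gd (fun _ h => rk_abcdef h.dB) fun _ =>
  .cb fun _ => .gd (fun _ h => nz_abc h.dC) fun _ =>
  .cb fun _ => .gd (fun _ h => rk_abcdef h.dC) fun _ =>
  .cb fun _ => .gd (fun _ h => nz_def h.dA) fun _ =>
  .cb fun _ => .gd (fun _ h => rk_abcdef h.dA) fun _ =>
  .cb fun _ =>
  .cb fun _ => .gd (fun _ h => h.e32) fun h32 =>
  .cb fun _ => .gd (fun _ h => nz_adg h.dD) fun _ => .gd (fun _ h => h.e02) fun h02 => .gd (fun _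
    h => h.e12) fun h12 =>
  .cb fun _ =>
  .cb fun _ => .gd (fun _ h => h.e34) fun h34 =>
  .cb fun _ => .gd (fun _ h => h.e04) fun h04 => .gd (fun _ h => h.e14) fun h14 => .gd (fun _ h =>
    rk_adgbeh h.dD) fun _ =>
  .cb fun _ => .gd (fun _ h => nz_ghi h.dD) fun _ =>
  .cb fun _ => .gd (fun _ h => h.e35) fun h35 => .gd (fun _ h => rk_defghi h.dD) fun _ =>
  .cb fun _ => .gd (fun _ h => h.e05) fun h05 => .gd (fun _ h => h.e15) fun h15 => .gd (fun _ h =>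
    h.dD) fun hD =>
  .cb fun _ => .gd (fun _ h => nz_beh h.dB) fun _ =>
  .cb fun _ => .gd (fun _ h => h.e44) fun h44 => .gd (fun _ h => h.e43) fun h43 => .gd (fun _ h =>
    h.e53) fun h53 => .gd (fun _ h => nz_beh h.dC) fun _ =>
  .cb fun _ => .gd (fun _ h => rk_adgbeh h.dC) fun _ =>
  .cb fun _ => .gd (fun _ h => nz_adg h.dA) fun _ =>
  .cb fun _ => .gd (fun _ h => h.e50) fun h50 => .gd (fun _ h => h.e20) fun h20 => .gd (fun _ h =>
    h.e40) fun h40 => .gd (fun _ h => rk_adgbeh h.dB) fun _ =>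
  .cb fun _ => .gd (fun _ h => h.e23) fun h23 => .gd (fun _ h => h.e41) fun h41 => .gd (fun _ h =>
    h.e51) fun h51 => .gd (fun _ h => h.e21) fun h21 => .gd (fun _ h => h.e22) fun h22 => .gd (fun
    _ h => rk_adgbeh h.dA) fun _ =>
  .cb fun _ => .gd (fun _ h => h.dC) fun hC =>
  .cb fun _ => .gd (fun _ h => h.e45) fun h45 => .gd (fun _ h => h.e54) fun h54 => .gd (fun _ h =>
    h.dB) fun hB =>
  .cb fun _ => .gd (fun _ h => h.e25) fun h25 => .gd (fun _ h => h.e52) fun h52 => .gd (fun _ h =>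
    h.e24) fun h24 => .gd (fun _ h => h.e42) fun h42 => .gd (fun _ h => h.dA) fun hA =>
  .one fun _ => ⟨hA, hB, hC, hD, h01, h02, h03, h04, h05, h10, h11, h12, h13, h14, h15, h20, h21,
    h22, h23, h24, h25, h30, h31, h32, h34, h35, h40, h41, h42, h43, h44, h45, h50, h51, h52, h53,
    h54⟩

/-! ### From matrices over `ZMod 2` to bits -/

/-- The bit of an element of `ZMod 2`. -/
def bt (z : ZMod 2) : Bool := decide (z = 1)

theorem bt_add : ∀ x y : ZMod 2, xo (bt x) (bt y) = bt (x + y) := by decide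
theorem bt_mul : ∀ x y : ZMod 2, an (bt x) (bt y) = bt (x * y) := by decide
theorem bt_eq : ∀ x y : ZMod 2, be (bt x) (bt y) = true ↔ x = y := by decide
theorem bt_zero_eq : ∀ y : ZMod 2, be false (bt y) = true ↔ 0 = y := by decide
theorem bt_eq_zero : ∀ y : ZMod 2, be (bt y) false = true ↔ y = 0 := by decide
theorem bt_inj : ∀ {x y : ZMod 2}, bt x = bt y → x = y := by decide
theorem bt_one : ∀ x : ZMod 2, bt x = true ↔ x ≠ 0 := by decide
theorem bt_ite : ∀ b : Bool, bt (if b then 1 else 0) = b := by decide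

theorem iff_of_sub {x y z w : ZMod 2} (h : x - y = z - w) : z = w ↔ x = y := by
  rw [← sub_eq_zero, ← h, sub_eq_zero]

abbrev M3 := Matrix (Fin 3) (Fin 3) (ZMod 2)

def lhs (A B C D : M3) : Matrix (Fin 6) (Fin 6) (ZMod 2) :=
  embed A 0 1 2 * embed B 0 3 4 * embed C 1 3 5 * embed D 2 4 5

def rhs (A B C D : M3) : Matrix (Fin 6) (Fin 6) (ZMod 2) :=
  embed D 2 4 5 * embed C 1 3 5 * embed B 0 3 4 * embed A 0 1 2

theorem dt_iff (A : M3) : dt (bt (A 0 0)) (bt (A 0 1)) (bt (A 0 2)) (bt (A 1 0)) (bt (A 1 1)) (bt (A 1 2)) (bt (A 2 0)) (bt (A 2 1)) (bt (A 2 2)) = true ↔ A.det ≠ 0 := by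
  rw [Matrix.det_fin_three, ← bt_one]
  simp only [dt, bt_mul, bt_add, CharTwo.sub_eq_add]
  ring_nf

/-- Every entry of the matrix equation is one of the Boolean equations (or trivial). -/
theorem entries (A B C D : M3) :
    (True ↔ lhs A B C D 0 0 = rhs A B C D 0 0) ∧
    (e01 (bt (A 0 0)) (bt (A 0 1)) (bt (B 0 0)) (bt (B 0 1)) (bt (C 0 0)) (bt (C 1 0)) = true ↔
      lhs A B C D 0 1 = rhs A B C D 0 1) ∧
    (e02 (bt (A 0 0)) (bt (A 0 1)) (bt (A 0 2)) (bt (B 0 0)) (bt (B 0 1)) (bt (B 0 2)) (bt (C 0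
      2)) (bt (C 1 2)) (bt (D 0 0)) (bt (D 1 0)) (bt (D 2 0)) = true ↔ lhs A B C D 0 2 = rhs A B C
      D 0 2) ∧
    (e03 (bt (A 0 0)) (bt (A 0 1)) (bt (B 0 1)) (bt (C 0 1)) (bt (C 1 1)) = true ↔ lhs A B C D 0 3
      = rhs A B C D 0 3) ∧
    (e04 (bt (A 0 0)) (bt (A 0 1)) (bt (A 0 2)) (bt (B 0 1)) (bt (B 0 2)) (bt (C 0 2)) (bt (C 1
      2)) (bt (D 0 1)) (bt (D 1 1)) (bt (D 2 1)) = true ↔ lhs A B C D 0 4 = rhs A B C D 0 4) ∧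
    (e05 (bt (A 0 0)) (bt (A 0 1)) (bt (A 0 2)) (bt (B 0 1)) (bt (B 0 2)) (bt (C 0 2)) (bt (C 1
      2)) (bt (D 0 2)) (bt (D 1 2)) (bt (D 2 2)) = true ↔ lhs A B C D 0 5 = rhs A B C D 0 5) ∧
    (e10 (bt (A 0 0)) (bt (A 1 0)) (bt (B 0 0)) (bt (B 1 0)) (bt (C 0 0)) (bt (C 0 1)) = true ↔
      lhs A B C D 1 0 = rhs A B C D 1 0) ∧
    (e11 (bt (A 0 1)) (bt (A 1 0)) (bt (B 0 1)) (bt (B 1 0)) (bt (C 0 1)) (bt (C 1 0)) = true ↔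
      lhs A B C D 1 1 = rhs A B C D 1 1) ∧
    (e12 (bt (A 0 2)) (bt (A 1 0)) (bt (A 1 1)) (bt (A 1 2)) (bt (B 0 1)) (bt (B 0 2)) (bt (B 1
      0)) (bt (C 0 0)) (bt (C 0 1)) (bt (C 0 2)) (bt (C 1 2)) (bt (D 0 0)) (bt (D 1 0)) (bt (D 2
      0)) = true ↔ lhs A B C D 1 2 = rhs A B C D 1 2) ∧
    (e13 (bt (A 1 0)) (bt (A 1 1)) (bt (B 0 1)) (bt (B 1 1)) (bt (C 0 1)) (bt (C 1 1)) = true ↔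
      lhs A B C D 1 3 = rhs A B C D 1 3) ∧
    (e14 (bt (A 1 0)) (bt (A 1 1)) (bt (A 1 2)) (bt (B 0 1)) (bt (B 0 2)) (bt (B 1 2)) (bt (C 0
      1)) (bt (C 0 2)) (bt (C 1 2)) (bt (D 0 1)) (bt (D 1 1)) (bt (D 2 1)) = true ↔ lhs A B C D 1
      4 = rhs A B C D 1 4) ∧
    (e15 (bt (A 1 0)) (bt (A 1 1)) (bt (A 1 2)) (bt (B 0 1)) (bt (B 0 2)) (bt (C 0 2)) (bt (C 1
      2)) (bt (D 0 2)) (bt (D 1 2)) (bt (D 2 2)) = true ↔ lhs A B C D 1 5 = rhs A B C D 1 5) ∧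
    (e20 (bt (A 0 0)) (bt (A 1 0)) (bt (A 2 0)) (bt (B 0 0)) (bt (B 1 0)) (bt (B 2 0)) (bt (C 2
      0)) (bt (C 2 1)) (bt (D 0 0)) (bt (D 0 1)) (bt (D 0 2)) = true ↔ lhs A B C D 2 0 = rhs A B C
      D 2 0) ∧
    (e21 (bt (A 0 1)) (bt (A 1 1)) (bt (A 2 0)) (bt (A 2 1)) (bt (B 0 1)) (bt (B 1 0)) (bt (B 2
      0)) (bt (C 0 0)) (bt (C 1 0)) (bt (C 2 0)) (bt (C 2 1)) (bt (D 0 0)) (bt (D 0 1)) (bt (D 0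
      2)) = true ↔ lhs A B C D 2 1 = rhs A B C D 2 1) ∧
    (e22 (bt (A 0 2)) (bt (A 1 2)) (bt (A 2 0)) (bt (A 2 1)) (bt (B 0 1)) (bt (B 0 2)) (bt (B 1
      0)) (bt (B 2 0)) (bt (C 0 2)) (bt (C 1 2)) (bt (C 2 0)) (bt (C 2 1)) (bt (D 0 1)) (bt (D 0
      2)) (bt (D 1 0)) (bt (D 2 0)) = true ↔ lhs A B C D 2 2 = rhs A B C D 2 2) ∧
    (e23 (bt (A 2 0)) (bt (A 2 1)) (bt (B 0 1)) (bt (B 1 1)) (bt (B 2 1)) (bt (C 0 1)) (bt (C 1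
      1)) (bt (C 2 1)) (bt (D 0 1)) (bt (D 0 2)) = true ↔ lhs A B C D 2 3 = rhs A B C D 2 3) ∧
    (e24 (bt (A 2 0)) (bt (A 2 1)) (bt (A 2 2)) (bt (B 0 1)) (bt (B 0 2)) (bt (B 1 2)) (bt (B 2
      2)) (bt (C 0 2)) (bt (C 1 2)) (bt (C 2 1)) (bt (D 0 1)) (bt (D 0 2)) (bt (D 1 1)) (bt (D 2
      1)) = true ↔ lhs A B C D 2 4 = rhs A B C D 2 4) ∧
    (e25 (bt (A 2 0)) (bt (A 2 1)) (bt (A 2 2)) (bt (B 0 1)) (bt (B 0 2)) (bt (C 0 2)) (bt (C 1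
      2)) (bt (C 2 2)) (bt (D 0 2)) (bt (D 1 2)) (bt (D 2 2)) = true ↔ lhs A B C D 2 5 = rhs A B C
      D 2 5) ∧
    (e30 (bt (A 0 0)) (bt (A 1 0)) (bt (B 1 0)) (bt (C 1 0)) (bt (C 1 1)) = true ↔ lhs A B C D 3 0
      = rhs A B C D 3 0) ∧
    (e31 (bt (A 0 1)) (bt (A 1 1)) (bt (B 1 0)) (bt (B 1 1)) (bt (C 1 0)) (bt (C 1 1)) = true ↔
      lhs A B C D 3 1 = rhs A B C D 3 1) ∧
    (e32 (bt (A 0 2)) (bt (A 1 2)) (bt (B 1 0)) (bt (B 1 1)) (bt (B 1 2)) (bt (C 1 0)) (bt (C 1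
      1)) (bt (C 1 2)) (bt (D 1 0)) (bt (D 2 0)) = true ↔ lhs A B C D 3 2 = rhs A B C D 3 2) ∧
    (True ↔ lhs A B C D 3 3 = rhs A B C D 3 3) ∧
    (e34 (bt (B 1 1)) (bt (B 1 2)) (bt (C 1 1)) (bt (C 1 2)) (bt (D 1 1)) (bt (D 2 1)) = true ↔
      lhs A B C D 3 4 = rhs A B C D 3 4) ∧
    (e35 (bt (B 1 1)) (bt (B 1 2)) (bt (C 1 2)) (bt (D 1 2)) (bt (D 2 2)) = true ↔ lhs A B C D 3 5
      = rhs A B C D 3 5) ∧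
    (e40 (bt (A 0 0)) (bt (A 1 0)) (bt (A 2 0)) (bt (B 1 0)) (bt (B 2 0)) (bt (C 2 0)) (bt (C 2
      1)) (bt (D 1 0)) (bt (D 1 1)) (bt (D 1 2)) = true ↔ lhs A B C D 4 0 = rhs A B C D 4 0) ∧
    (e41 (bt (A 0 1)) (bt (A 1 1)) (bt (A 2 1)) (bt (B 1 0)) (bt (B 2 0)) (bt (B 2 1)) (bt (C 1
      0)) (bt (C 2 0)) (bt (C 2 1)) (bt (D 1 0)) (bt (D 1 1)) (bt (D 1 2)) = true ↔ lhs A B C D 4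
      1 = rhs A B C D 4 1) ∧
    (e42 (bt (A 0 2)) (bt (A 1 2)) (bt (A 2 2)) (bt (B 1 0)) (bt (B 2 0)) (bt (B 2 1)) (bt (B 2
      2)) (bt (C 1 2)) (bt (C 2 0)) (bt (C 2 1)) (bt (D 1 0)) (bt (D 1 1)) (bt (D 1 2)) (bt (D 2
      0)) = true ↔ lhs A B C D 4 2 = rhs A B C D 4 2) ∧
    (e43 (bt (B 1 1)) (bt (B 2 1)) (bt (C 1 1)) (bt (C 2 1)) (bt (D 1 1)) (bt (D 1 2)) = true ↔
      lhs A B C D 4 3 = rhs A B C D 4 3) ∧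
    (e44 (bt (B 1 2)) (bt (B 2 1)) (bt (C 1 2)) (bt (C 2 1)) (bt (D 1 2)) (bt (D 2 1)) = true ↔
      lhs A B C D 4 4 = rhs A B C D 4 4) ∧
    (e45 (bt (B 2 1)) (bt (B 2 2)) (bt (C 1 2)) (bt (C 2 2)) (bt (D 1 2)) (bt (D 2 2)) = true ↔
      lhs A B C D 4 5 = rhs A B C D 4 5) ∧
    (e50 (bt (A 0 0)) (bt (A 1 0)) (bt (A 2 0)) (bt (B 1 0)) (bt (B 2 0)) (bt (C 2 0)) (bt (C 2
      1)) (bt (D 2 0)) (bt (D 2 1)) (bt (D 2 2)) = true ↔ lhs A B C D 5 0 = rhs A B C D 5 0) ∧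
    (e51 (bt (A 0 1)) (bt (A 1 1)) (bt (A 2 1)) (bt (B 1 0)) (bt (B 2 0)) (bt (C 2 0)) (bt (C 2
      1)) (bt (D 2 0)) (bt (D 2 1)) (bt (D 2 2)) = true ↔ lhs A B C D 5 1 = rhs A B C D 5 1) ∧
    (e52 (bt (A 0 2)) (bt (A 1 2)) (bt (A 2 2)) (bt (B 1 0)) (bt (B 2 0)) (bt (C 2 0)) (bt (C 2
      1)) (bt (C 2 2)) (bt (D 2 0)) (bt (D 2 1)) (bt (D 2 2)) = true ↔ lhs A B C D 5 2 = rhs A B C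
      D 5 2) ∧
    (e53 (bt (B 1 1)) (bt (B 2 1)) (bt (C 2 1)) (bt (D 2 1)) (bt (D 2 2)) = true ↔ lhs A B C D 5 3
      = rhs A B C D 5 3) ∧
    (e54 (bt (B 1 2)) (bt (B 2 2)) (bt (C 2 1)) (bt (C 2 2)) (bt (D 2 1)) (bt (D 2 2)) = true ↔
      lhs A B C D 5 4 = rhs A B C D 5 4) ∧
    (True ↔ lhs A B C D 5 5 = rhs A B C D 5 5) := by
  refine ⟨?_, ?_, ?_, ?_, ?_, ?_, ?_, ?_, ?_, ?_, ?_, ?_, ?_, ?_, ?_, ?_, ?_, ?_, ?_, ?_, ?_, ?_,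
    ?_, ?_, ?_, ?_, ?_, ?_, ?_, ?_, ?_, ?_, ?_, ?_, ?_, ?_⟩ <;>
  simp only [e01, e02, e03, e04, e05, e10, e11, e12, e13, e14, e15, e20, e21, e22, e23, e24, e25,
    e30, e31, e32, e34, e35, e40, e41, e42, e43, e44, e45, e50, e51, e52, e53, e54, rq, bt_mul,
    bt_add, bt_eq, bt_zero_eq, bt_eq_zero, lhs, rhs, Matrix.mul_apply, Fin.sum_univ_six, embed,
    Fin.isValue, Fin.reduceEq, reduceIte, zero_mul, mul_zero, one_mul, mul_one, add_zero,
    zero_add] <;>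
  first | exact iff_of_sub (by ring) | exact ⟨fun _ => by ring, fun _ => trivial⟩

theorem sol_iff (A B C D : M3) : Sol (bt (A 0 0)) (bt (A 0 1)) (bt (A 0 2)) (bt (A 1 0)) (bt (A 1
    1)) (bt (A 1 2)) (bt (A 2 0)) (bt (A 2 1)) (bt (A 2 2)) (bt (B 0 0)) (bt (B 0 1)) (bt (B 0 2))
    (bt (B 1 0)) (bt (B 1 1)) (bt (B 1 2)) (bt (B 2 0)) (bt (B 2 1)) (bt (B 2 2)) (bt (C 0 0)) (bt
    (C 0 1)) (bt (C 0 2)) (bt (C 1 0)) (bt (C 1 1)) (bt (C 1 2)) (bt (C 2 0)) (bt (C 2 1)) (bt (C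
    2 2)) (bt (D 0 0)) (bt (D 0 1)) (bt (D 0 2)) (bt (D 1 0)) (bt (D 1 1)) (bt (D 1 2)) (bt (D 2
    0)) (bt (D 2 1)) (bt (D 2 2)) ↔ A.det ≠ 0 ∧ B.det ≠ 0 ∧ C.det ≠ 0 ∧ D.det ≠ 0 ∧ lhs A B C D =
    rhs A B C D := by
  obtain ⟨e00, e01, e02, e03, e04, e05, e10, e11, e12, e13, e14, e15, e20, e21, e22, e23, e24,
    e25, e30, e31, e32, e33, e34, e35, e40, e41, e42, e43, e44, e45, e50, e51, e52, e53, e54, e55⟩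
    := entries A B C D
  constructor
  · intro h
    refine ⟨(dt_iff A).1 h.dA, (dt_iff B).1 h.dB, (dt_iff C).1 h.dC, (dt_iff D).1 h.dD, ?_⟩
    ext i j
    fin_cases i <;> fin_cases j
    exacts [e00.1 trivial, e01.1 h.e01, e02.1 h.e02, e03.1 h.e03, e04.1 h.e04, e05.1 h.e05, e10.1
      h.e10, e11.1 h.e11, e12.1 h.e12, e13.1 h.e13, e14.1 h.e14, e15.1 h.e15, e20.1 h.e20, e21.1
      h.e21, e22.1 h.e22, e23.1 h.e23, e24.1 h.e24, e25.1 h.e25, e30.1 h.e30, e31.1 h.e31, e32.1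
      h.e32, e33.1 trivial, e34.1 h.e34, e35.1 h.e35, e40.1 h.e40, e41.1 h.e41, e42.1 h.e42, e43.1
      h.e43, e44.1 h.e44, e45.1 h.e45, e50.1 h.e50, e51.1 h.e51, e52.1 h.e52, e53.1 h.e53, e54.1
      h.e54, e55.1 trivial]
  · rintro ⟨hA, hB, hC, hD, h⟩
    have h' := fun i j => congrFun (congrFun h i) j
    exact ⟨(dt_iff A).2 hA, (dt_iff B).2 hB, (dt_iff C).2 hC, (dt_iff D).2 hD, e01.2 (h' _ _),
      e02.2 (h' _ _), e03.2 (h' _ _), e04.2 (h' _ _), e05.2 (h' _ _), e10.2 (h' _ _), e11.2 (h' _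
      _), e12.2 (h' _ _), e13.2 (h' _ _), e14.2 (h' _ _), e15.2 (h' _ _), e20.2 (h' _ _), e21.2
      (h' _ _), e22.2 (h' _ _), e23.2 (h' _ _), e24.2 (h' _ _), e25.2 (h' _ _), e30.2 (h' _ _),
      e31.2 (h' _ _), e32.2 (h' _ _), e34.2 (h' _ _), e35.2 (h' _ _), e40.2 (h' _ _), e41.2 (h' _
      _), e42.2 (h' _ _), e43.2 (h' _ _), e44.2 (h' _ _), e45.2 (h' _ _), e50.2 (h' _ _), e51.2
      (h' _ _), e52.2 (h' _ _), e53.2 (h' _ _), e54.2 (h' _ _)⟩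

/-- The vector of bits of four matrices, in the order of the search. -/
def bits (A B C D : M3) : Fin 36 → Bool :=
  ![bt (A 0 0), bt (B 1 0), bt (C 1 0), bt (C 1 1), bt (A 1 0), bt (A 0 1), bt (B 0 1), bt (C 0
    1), bt (A 1 1), bt (B 1 1), bt (C 0 0), bt (B 0 0), bt (B 0 2), bt (B 1 2), bt (C 0 2), bt (C
    1 2), bt (A 1 2), bt (A 0 2), bt (D 1 0), bt (D 2 0), bt (D 0 0), bt (D 1 1), bt (D 2 1), bt
    (D 0 1), bt (D 2 2), bt (D 1 2), bt (D 0 2), bt (B 2 1), bt (C 2 1), bt (C 2 0), bt (A 2 0),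
    bt (B 2 0), bt (A 2 1), bt (C 2 2), bt (B 2 2), bt (A 2 2)]

theorem solV_bits (A B C D : M3) : SolV (bits A B C D) ↔
    A.det ≠ 0 ∧ B.det ≠ 0 ∧ C.det ≠ 0 ∧ D.det ≠ 0 ∧ lhs A B C D = rhs A B C D :=
  sol_iff A B C D

theorem bits_inj {A B C D A' B' C' D' : M3} (h : bits A B C D = bits A' B' C' D') :
    A = A' ∧ B = B' ∧ C = C' ∧ D = D' := by
  have h' := fun i => congrFun h i
  refine ⟨?_, ?_, ?_, ?_⟩ <;> ext i j <;> fin_cases i <;> fin_cases j <;> apply bt_inj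
  exacts [h' 0, h' 5, h' 17, h' 4, h' 8, h' 16, h' 30, h' 32, h' 35, h' 11, h' 6, h' 12, h' 1, h'
    9, h' 13, h' 31, h' 27, h' 34, h' 10, h' 7, h' 14, h' 2, h' 3, h' 15, h' 29, h' 28, h' 33, h'
    20, h' 23, h' 26, h' 18, h' 21, h' 25, h' 19, h' 22, h' 24]

/-- The matrix over `ZMod 2` with nine given bits. -/
def mt (x : Fin 36 → Bool) (k : Fin 3 → Fin 3 → Fin 36) : M3 :=
  fun i j => if x (k i j) then 1 else 0

theorem bits_surj (x : Fin 36 → Bool) : ∃ A B C D : M3, bits A B C D = x := by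
  refine ⟨mt x ![![0, 5, 17], ![4, 8, 16], ![30, 32, 35]],
    mt x ![![11, 6, 12], ![1, 9, 13], ![31, 27, 34]],
    mt x ![![10, 7, 14], ![2, 3, 15], ![29, 28, 33]],
    mt x ![![20, 23, 26], ![18, 21, 25], ![19, 22, 24]], ?_⟩
  funext i
  fin_cases i <;> exact bt_ite _

end

end Tet

open Tet

/-- There are exactly 61535 quadruples of invertible 3×3 matrices over `𝔽₂` satisfying
the direct-sum tetrahedron equation. -/
theorem count_direct_sum_tetrahedron_solutions :
    Nat.card {t : GL (Fin 3) (ZMod 2) × GL (Fin 3) (ZMod 2) × GL (Fin 3) (ZMod 2) ×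
        GL (Fin 3) (ZMod 2) //
      embed (t.1 : Matrix (Fin 3) (Fin 3) (ZMod 2)) 0 1 2 *
          embed (t.2.1 : Matrix (Fin 3) (Fin 3) (ZMod 2)) 0 3 4 *
          embed (t.2.2.1 : Matrix (Fin 3) (Fin 3) (ZMod 2)) 1 3 5 *
          embed (t.2.2.2 : Matrix (Fin 3) (Fin 3) (ZMod 2)) 2 4 5 =
        embed (t.2.2.2 : Matrix (Fin 3) (Fin 3) (ZMod 2)) 2 4 5 *
          embed (t.2.2.1 : Matrix (Fin 3) (Fin 3) (ZMod 2)) 1 3 5 *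
          embed (t.2.1 : Matrix (Fin 3) (Fin 3) (ZMod 2)) 0 3 4 *
          embed (t.1 : Matrix (Fin 3) (Fin 3) (ZMod 2)) 0 1 2} = 61535 := by
  rw [← L0_eq]
  refine Eq.trans ?_ count_L0
  refine Nat.card_eq_of_bijective (fun t => ⟨bits t.1.1 t.1.2.1 t.1.2.2.1 t.1.2.2.2,
    (solV_bits _ _ _ _).2 ⟨?_, ?_, ?_, ?_, t.2⟩⟩) ⟨?_, ?_⟩
  · exact ((Matrix.isUnit_iff_isUnit_det _).1 t.1.1.isUnit).ne_zero
  · exact ((Matrix.isUnit_iff_isUnit_det _).1 t.1.2.1.isUnit).ne_zero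
  · exact ((Matrix.isUnit_iff_isUnit_det _).1 t.1.2.2.1.isUnit).ne_zero
  · exact ((Matrix.isUnit_iff_isUnit_det _).1 t.1.2.2.2.isUnit).ne_zero
  · rintro ⟨⟨A, B, C, D⟩, h⟩ ⟨⟨A', B', C', D'⟩, h'⟩ e
    obtain ⟨hA, hB, hC, hD⟩ := bits_inj (congrArg Subtype.val e)
    obtain rfl := Units.ext hA
    obtain rfl := Units.ext hB
    obtain rfl := Units.ext hC
    obtain rfl := Units.ext hD
    rfl
  · rintro ⟨x, hx⟩
    obtain ⟨A, B, C, D, rfl⟩ := bits_surj x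
    obtain ⟨hA, hB, hC, hD, h⟩ := (solV_bits _ _ _ _).1 hx
    exact ⟨⟨(Matrix.GeneralLinearGroup.mkOfDetNeZero A hA,
      Matrix.GeneralLinearGroup.mkOfDetNeZero B hB,
      Matrix.GeneralLinearGroup.mkOfDetNeZero C hC,
      Matrix.GeneralLinearGroup.mkOfDetNeZero D hD), h⟩, rfl⟩
end
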